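/- arXiv:1806.08444 — 2 statements merged into one kernel-verified Lean document; each statement's English description precedes it below -/
import Mathlib

section
/- Let z be a random vector taking values in ℝⁿ whose law admits a probability density function p with respect to Lebesgue measure, and for each m ∈ ℕ let z^m be the ℤⁿ-valued random vector with coordinates z^m[i] = ⌊2^m · z[i]⌋. Assume (a) p is continuous and bounded, (b) ∫ |p(z) log p(z)| dz < ∞, and (c) the Shannon entropy H(z⁰) is finite. Then lim_{m→∞} (H(z^m) − m·n·log 2) = −∫ p(z) log p(z) dz; that is, the Shannon entropy of the discretization, corrected by m·n·log 2, converges to the differential entropy of z. -/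
open MeasureTheory ProbabilityTheory Filter

/-- Shannon entropy of a `ℤⁿ`-valued random vector (natural logarithm,
with the convention `0 · log 0 = 0` built into `Real.negMulLog`). -/
noncomputable def shannonEntropy {Ω : Type*} [MeasurableSpace Ω] {n : ℕ}
    (P : Measure Ω) (a : Ω → (Fin n → ℤ)) : ℝ :=
  ∑' k : Fin n → ℤ, Real.negMulLog (P (a ⁻¹' {k})).toReal

/-- Generalised dominated convergence (Pratt's lemma). -/
lemma pratt_aux {α : Type*} [MeasurableSpace α] {μ : Measure α}
    (a s : ℕ → α → ℝ) (a0 s0 : α → ℝ)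
    (ha : ∀ m, Integrable (a m) μ) (hs : ∀ m, Integrable (s m) μ) (hs0 : Integrable s0 μ)
    (h0 : ∀ m x, 0 ≤ a m x) (has : ∀ m x, a m x ≤ s m x)
    (hal : ∀ x, Tendsto (fun m => a m x) atTop (nhds (a0 x)))
    (hsl : ∀ x, Tendsto (fun m => s m x) atTop (nhds (s0 x)))
    (hI : ∀ m, ∫ x, s m x ∂μ = ∫ x, s0 x ∂μ) :
    Tendsto (fun m => ∫ x, a m x ∂μ) atTop (nhds (∫ x, a0 x ∂μ)) := by
  have hs00 : ∀ x, 0 ≤ s0 x := fun x =>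
    ge_of_tendsto' (hsl x) (fun m => (h0 m x).trans (has m x))
  have ha0s0 : ∀ x, a0 x ≤ s0 x := fun x =>
    le_of_tendsto_of_tendsto' (hal x) (hsl x) (fun m => has m x)
  have hma : ∀ m, Integrable (fun x => min (a m x) (s0 x)) μ := fun m => (ha m).inf hs0
  have hms : ∀ m, Integrable (fun x => min (s m x) (s0 x)) μ := fun m => (hs m).inf hs0
  have h1 : Tendsto (fun m => ∫ x, min (a m x) (s0 x) ∂μ) atTop (nhds (∫ x, a0 x ∂μ)) := by
    refine tendsto_integral_of_dominated_convergence s0 (fun m => (hma m).1) hs0 ?_ ?_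
    · intro m
      filter_upwards with x
      rw [Real.norm_of_nonneg (le_min (h0 m x) (hs00 x))]
      exact min_le_right _ _
    · filter_upwards with x
      have := (hal x).min (tendsto_const_nhds (x := s0 x))
      rwa [min_eq_left (ha0s0 x)] at this
  have h2 : Tendsto (fun m => ∫ x, min (s m x) (s0 x) ∂μ) atTop (nhds (∫ x, s0 x ∂μ)) := by
    refine tendsto_integral_of_dominated_convergence s0 (fun m => (hms m).1) hs0 ?_ ?_
    · intro m
      filter_upwards with x
      rw [Real.norm_of_nonneg (le_min ((h0 m x).trans (has m x)) (hs00 x))]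
      exact min_le_right _ _
    · filter_upwards with x
      have := (hsl x).min (tendsto_const_nhds (x := s0 x))
      rwa [min_self] at this
  have h3 : Tendsto (fun m => ∫ x, min (a m x) (s0 x) ∂μ +
      (∫ x, s0 x ∂μ - ∫ x, min (s m x) (s0 x) ∂μ)) atTop (nhds (∫ x, a0 x ∂μ)) := by
    have := h1.add ((tendsto_const_nhds (x := ∫ x, s0 x ∂μ)).sub h2)
    simpa using this
  refine tendsto_of_tendsto_of_tendsto_of_le_of_le h1 h3 ?_ ?_
  · intro m
    exact integral_mono (hma m) (ha m) (fun x => min_le_left _ _)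
  · intro m
    dsimp only
    rw [← hI m, ← integral_sub (hs m) (hms m)]
    have hsub : Integrable (fun x => s m x - min (s m x) (s0 x)) μ := (hs m).sub (hms m)
    rw [← integral_add (hma m) hsub]
    refine integral_mono (ha m) ((hma m).add hsub) (fun x => ?_)
    have := has m x
    rcases le_total (a m x) (s0 x) with h | h <;> rcases le_total (s m x) (s0 x) with h' | h' <;>
      simp [h, h'] <;> linarith

/-- The dyadic cell index. -/
noncomputable def qcell {n : ℕ} (m : ℕ) (x : Fin n → ℝ) : Fin n → ℤ :=
  fun i => ⌊(2 : ℝ) ^ m * x i⌋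

lemma measurable_qcell {n : ℕ} (m : ℕ) : Measurable (qcell (n := n) m) := by
  unfold qcell
  refine measurable_pi_iff.2 fun i => ?_
  exact Int.measurable_floor.comp ((measurable_pi_apply i).const_mul _)

lemma qcell_preimage {n : ℕ} (m : ℕ) (k : Fin n → ℤ) :
    qcell m ⁻¹' {k} = Set.univ.pi fun i => Set.Ico ((k i : ℝ) / 2 ^ m) (((k i : ℝ) + 1) / 2 ^ m) := by
  ext x
  have h2 : (0 : ℝ) < 2 ^ m := by positivity
  simp only [qcell, Set.mem_preimage, Set.mem_singleton_iff, funext_iff, Int.floor_eq_iff,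
    Set.mem_pi, Set.mem_univ, true_imp_iff, Set.mem_Ico, div_le_iff₀ h2, lt_div_iff₀ h2]
  simp only [mul_comm]

lemma volume_qcell {n : ℕ} (m : ℕ) (k : Fin n → ℤ) :
    volume (qcell m ⁻¹' {k}) = ENNReal.ofReal (((2 : ℝ) ^ (m * n))⁻¹) := by
  rw [qcell_preimage, Real.volume_pi_Ico]
  have : ∀ i, ((k i : ℝ) + 1) / 2 ^ m - (k i : ℝ) / 2 ^ m = ((2 : ℝ) ^ m)⁻¹ := by
    intro i; ring
  simp only [this, Finset.prod_const, Finset.card_univ, Fintype.card_fin]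
  rw [← ENNReal.ofReal_pow (by positivity), inv_pow, pow_mul]

lemma qcell_dist {n : ℕ} (m : ℕ) (x y : Fin n → ℝ) (h : qcell m y = qcell m x) :
    dist y x ≤ (1 / 2 : ℝ) ^ m := by
  rw [dist_pi_le_iff (by positivity)]
  intro i
  have h2 : (0 : ℝ) < 2 ^ m := by positivity
  have hi : ⌊(2 : ℝ) ^ m * y i⌋ = ⌊(2 : ℝ) ^ m * x i⌋ := congrFun h i
  have h3 := (Int.abs_sub_lt_one_of_floor_eq_floor hi).le
  rw [← mul_sub, abs_mul, abs_of_pos h2] at h3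
  rw [Real.dist_eq, one_div, inv_pow, ← one_div, le_div_iff₀ h2]
  linarith

lemma qcell_zero {n : ℕ} (m : ℕ) (x : Fin n → ℝ) :
    qcell 0 x = fun i => ⌊(qcell m x i : ℝ) / 2 ^ m⌋ := by
  funext i
  have h2 : (0 : ℝ) < 2 ^ m := by positivity
  simp only [qcell, pow_zero, one_mul]
  symm
  rw [Int.floor_eq_iff]
  rw [le_div_iff₀ h2, div_lt_iff₀ h2]
  constructor
  · have : (⌊x i⌋ * 2 ^ m : ℤ) ≤ ⌊(2 : ℝ) ^ m * x i⌋ := by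
      rw [Int.le_floor]
      push_cast
      nlinarith [Int.floor_le (x i)]
    exact_mod_cast this
  · have := Int.floor_le ((2 : ℝ) ^ m * x i)
    nlinarith [Int.lt_floor_add_one (x i)]

/-- Cell averages of a measure. -/
noncomputable def pavg {n : ℕ} (ν : Measure (Fin n → ℝ)) (m : ℕ) (x : Fin n → ℝ) : ℝ :=
  2 ^ (m * n) * ν.real (qcell m ⁻¹' {qcell m x})

lemma map_qcell_eq {n : ℕ} (ν : Measure (Fin n → ℝ)) [IsProbabilityMeasure ν] (m : ℕ) :
    ν.map (qcell m) = (volume.map (qcell (n := n) m)).withDensity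
      (fun k => ENNReal.ofReal (2 ^ (m * n) * ν.real (qcell m ⁻¹' {k}))) := by
  refine Measure.ext_of_singleton fun k => ?_
  rw [withDensity_apply _ (measurableSet_singleton k), lintegral_singleton,
    Measure.map_apply (measurable_qcell m) (measurableSet_singleton k),
    Measure.map_apply (measurable_qcell m) (measurableSet_singleton k), volume_qcell,
    ← ENNReal.ofReal_mul (by positivity)]
  rw [mul_right_comm, mul_inv_cancel₀ (by positivity), one_mul, ofReal_measureReal]

lemma lemA {n : ℕ} (ν : Measure (Fin n → ℝ)) [IsProbabilityMeasure ν] (m : ℕ)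
    (G : (Fin n → ℤ) → ℝ) :
    (Integrable (fun x => pavg ν m x * G (qcell m x)) ↔ Integrable (fun x => G (qcell m x)) ν) ∧
      ∫ x, pavg ν m x * G (qcell m x) = ∫ x, G (qcell m x) ∂ν := by
  have hq := measurable_qcell (n := n) m
  have e1 : (fun x => pavg ν m x * G (qcell m x)) =
    (fun k => (ENNReal.ofReal (2 ^ (m * n) * ν.real (qcell m ⁻¹' {k}))).toReal • G k) ∘ qcell m := by
    funext x
    simp only [pavg, Function.comp, smul_eq_mul]
    rw [ENNReal.toReal_ofReal (by positivity)]
  have hG : ∀ F : (Fin n → ℤ) → ℝ, Measurable F := fun F => measurable_of_countable _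
  have hG' : Measurable (fun k : Fin n → ℤ => ENNReal.ofReal (2 ^ (m * n) * ν.real (qcell m ⁻¹' {k}))) :=
    measurable_of_countable _
  constructor
  · rw [e1, ← integrable_map_measure (hG _).aestronglyMeasurable hq.aemeasurable,
      ← integrable_withDensity_iff_integrable_smul' hG' (ae_of_all _ fun _ => ENNReal.ofReal_lt_top), ← map_qcell_eq,
      integrable_map_measure (hG _).aestronglyMeasurable hq.aemeasurable]
    rfl
  · rw [e1]
    change ∫ x, (fun k : Fin n → ℤ => (ENNReal.ofReal (2 ^ (m * n) * ν.real (qcell m ⁻¹' {k}))).toReal • G k) (qcell m x) = _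
    rw [← integral_map (f := fun k : Fin n → ℤ => (ENNReal.ofReal (2 ^ (m * n) * ν.real (qcell m ⁻¹' {k}))).toReal • G k) hq.aemeasurable (hG _).aestronglyMeasurable,
      ← integral_withDensity_eq_integral_toReal_smul hG' (ae_of_all _ fun _ => ENNReal.ofReal_lt_top), ← map_qcell_eq,
      integral_map hq.aemeasurable (hG _).aestronglyMeasurable]

lemma map_volume_qcell {n : ℕ} (m : ℕ) : volume.map (qcell (n := n) m) =
    ENNReal.ofReal (((2 : ℝ) ^ (m * n))⁻¹) • Measure.count := by
  refine Measure.ext_of_singleton fun k => ?_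
  rw [Measure.map_apply (measurable_qcell m) (measurableSet_singleton k), volume_qcell]
  simp

lemma lemB {n : ℕ} (m : ℕ) (F : (Fin n → ℤ) → ℝ) :
    (Integrable (fun x : Fin n → ℝ => F (qcell m x)) ↔ Summable F) ∧
    (Summable F → ∫ x : Fin n → ℝ, F (qcell m x) = ((2 : ℝ) ^ (m * n))⁻¹ * ∑' k, F k) := by
  have hq := measurable_qcell (n := n) m
  have hF : Measurable F := measurable_of_countable _
  have hc : Integrable F Measure.count ↔ Summable F := by
    rw [integrable_count_iff]; exact summable_norm_iff
  have hpos : (0 : ℝ) < ((2 : ℝ) ^ (m * n))⁻¹ := by positivity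
  have hne : ENNReal.ofReal (((2 : ℝ) ^ (m * n))⁻¹) ≠ 0 := by
    rw [Ne, ENNReal.ofReal_eq_zero, not_le]; exact hpos
  have h1 : (Integrable (fun x : Fin n → ℝ => F (qcell m x)) ↔ Summable F) := by
    rw [← hc, show (fun x : Fin n → ℝ => F (qcell m x)) = F ∘ qcell m from rfl,
      ← integrable_map_measure hF.aestronglyMeasurable hq.aemeasurable, map_volume_qcell]
    rw [integrable_smul_measure hne ENNReal.ofReal_ne_top]
  refine ⟨h1, fun hs => ?_⟩
  rw [← integral_map hq.aemeasurable hF.aestronglyMeasurable, map_volume_qcell,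
    integral_smul_measure, integral_countable (hc.2 hs),
    ENNReal.toReal_ofReal hpos.le, smul_eq_mul]
  congr 1
  refine tsum_congr fun k => ?_
  simp [Measure.real]

lemma pavg_le {n : ℕ} (p : (Fin n → ℝ) → ℝ) (ν : Measure (Fin n → ℝ))
    (hν : ν = volume.withDensity (fun x => ENNReal.ofReal (p x))) (m : ℕ) (x : Fin n → ℝ)
    (C : ℝ) (hC : 0 ≤ C) (h : ∀ y, qcell m y = qcell m x → p y ≤ C) : pavg ν m x ≤ C := by
  have hms : MeasurableSet (qcell m ⁻¹' {qcell m x}) :=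
    measurable_qcell m (measurableSet_singleton _)
  have h1 : ν (qcell m ⁻¹' {qcell m x}) ≤ ENNReal.ofReal (C * ((2 : ℝ) ^ (m * n))⁻¹) := by
    rw [hν, withDensity_apply _ hms, ENNReal.ofReal_mul hC, ← volume_qcell m (qcell m x),
      ← setLIntegral_const]
    exact setLIntegral_mono' hms fun y hy => ENNReal.ofReal_le_ofReal (h y hy)
  have h2 := ENNReal.toReal_le_of_le_ofReal (by positivity) h1
  unfold pavg Measure.real
  rw [← div_eq_mul_inv, le_div_iff₀ (by positivity)] at h2
  linarith

lemma le_pavg {n : ℕ} (p : (Fin n → ℝ) → ℝ) (ν : Measure (Fin n → ℝ)) [IsProbabilityMeasure ν]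
    (hν : ν = volume.withDensity (fun x => ENNReal.ofReal (p x))) (m : ℕ) (x : Fin n → ℝ)
    (C : ℝ) (h : ∀ y, qcell m y = qcell m x → C ≤ p y) : C ≤ pavg ν m x := by
  rcases le_total C 0 with hC | hC
  · exact hC.trans (by unfold pavg; positivity)
  have hms : MeasurableSet (qcell m ⁻¹' {qcell m x}) :=
    measurable_qcell m (measurableSet_singleton _)
  have h1 : ENNReal.ofReal (C * ((2 : ℝ) ^ (m * n))⁻¹) ≤ ν (qcell m ⁻¹' {qcell m x}) := by
    rw [hν, withDensity_apply _ hms, ENNReal.ofReal_mul hC, ← volume_qcell m (qcell m x),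
      ← setLIntegral_const]
    exact setLIntegral_mono' hms fun y hy => ENNReal.ofReal_le_ofReal (h y hy)
  have h2 := (ENNReal.ofReal_le_iff_le_toReal (measure_ne_top _ _)).1 h1
  unfold pavg Measure.real
  rw [← div_eq_mul_inv, div_le_iff₀ (by positivity)] at h2
  linarith

lemma pavg_tendsto {n : ℕ} (p : (Fin n → ℝ) → ℝ) (hp : ∀ x, 0 ≤ p x) (hc : Continuous p)
    (ν : Measure (Fin n → ℝ)) [IsProbabilityMeasure ν]
    (hν : ν = volume.withDensity (fun x => ENNReal.ofReal (p x))) (x : Fin n → ℝ) :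
    Tendsto (fun m => pavg ν m x) atTop (nhds (p x)) := by
  rw [Metric.tendsto_atTop']
  intro ε hε
  obtain ⟨δ, hδ, hd⟩ := Metric.continuous_iff.1 hc x (ε / 2) (by positivity)
  obtain ⟨N, hN⟩ := exists_pow_lt_of_lt_one hδ (by norm_num : (1 / 2 : ℝ) < 1)
  refine ⟨N, fun m hm => ?_⟩
  have key : ∀ y, qcell m y = qcell m x → |p y - p x| < ε / 2 := by
    intro y hy
    rw [← Real.dist_eq]
    refine hd y ((qcell_dist m x y hy).trans_lt (lt_of_le_of_lt ?_ hN))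
    exact pow_le_pow_of_le_one (by norm_num) (by norm_num) hm.le
  have h1 := pavg_le p ν hν m x (p x + ε / 2) (by linarith [hp x])
    (fun y hy => by linarith [(abs_lt.1 (key y hy)).2])
  have h2 := le_pavg p ν hν m x (p x - ε / 2)
    (fun y hy => by linarith [(abs_lt.1 (key y hy)).1])
  rw [Real.dist_eq, abs_lt]
  constructor <;> linarith

lemma ent_ineq (y c : ℝ) (hy : 0 ≤ y) (hc : 0 ≤ c) (h : c = 0 → y = 0) :
    Real.negMulLog y ≤ -(y * Real.log c) - y + c := by
  rcases hy.eq_or_lt with rfl | hy'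
  · simpa using hc
  have hc' : 0 < c := lt_of_le_of_ne hc fun h' => hy'.ne' (h h'.symm)
  have h1 := Real.log_le_sub_one_of_pos (div_pos hc' hy')
  rw [Real.log_div hc'.ne' hy'.ne'] at h1
  have h2 := mul_le_mul_of_nonneg_left h1 hy
  have h3 : y * (c / y - 1) = c - y := by field_simp
  rw [h3] at h2
  unfold Real.negMulLog
  linarith

lemma core {n : ℕ} (p : (Fin n → ℝ) → ℝ) (hp : ∀ x, 0 ≤ p x) (hc : Continuous p)
    (C : ℝ) (hC1 : 1 ≤ C) (hC : ∀ x, p x ≤ C)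
    (ν : Measure (Fin n → ℝ)) [IsProbabilityMeasure ν]
    (hν : ν = volume.withDensity (fun x => ENNReal.ofReal (p x)))
    (hplogp : Integrable (fun x => p x * Real.log (p x)))
    (hH0 : Summable fun k : Fin n → ℤ => Real.negMulLog (ν.real (qcell 0 ⁻¹' {k}))) :
    Tendsto (fun m : ℕ => ∑' k : Fin n → ℤ, Real.negMulLog (ν.real (qcell m ⁻¹' {k}))
      - (m : ℝ) * (n : ℝ) * Real.log 2) atTop (nhds (-∫ x, p x * Real.log (p x))) := by
  have hpm : Measurable (fun x => ENNReal.ofReal (p x)) :=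
    ENNReal.measurable_ofReal.comp hc.measurable
  have hlt : ∀ᵐ x ∂(volume : Measure (Fin n → ℝ)), ENNReal.ofReal (p x) < ⊤ :=
    ae_of_all _ fun _ => ENNReal.ofReal_lt_top
  have hpI : ∀ g : (Fin n → ℝ) → ℝ, Integrable g ν → Integrable (fun x => p x * g x) := by
    intro g hg
    rw [hν, integrable_withDensity_iff_integrable_smul' hpm hlt] at hg
    simpa only [ENNReal.toReal_ofReal (hp _), smul_eq_mul] using hg
  have hpE : ∀ g : (Fin n → ℝ) → ℝ, ∫ x, p x * g x = ∫ x, g x ∂ν := by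
    intro g
    rw [hν, integral_withDensity_eq_integral_toReal_smul hpm hlt]
    simp only [ENNReal.toReal_ofReal (hp _), smul_eq_mul]
  have hp1 : Integrable p := by simpa using hpI (fun _ => 1) (integrable_const 1)
  have hp1E : ∫ x, p x = 1 := by simpa using hpE (fun _ => 1)
  have ha1 : ∀ m, Integrable (pavg ν m) := fun m => by
    simpa using (lemA ν m (fun _ => 1)).1.2 (integrable_const 1)
  have ha1E : ∀ m, ∫ x, pavg ν m x = 1 := fun m => by
    simpa using (lemA ν m (fun _ => 1)).2
  set L : (Fin n → ℤ) → ℝ := fun k => Real.log (ν.real (qcell 0 ⁻¹' {k})) with hL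
  have hp0 : ∀ x, pavg ν 0 x = ν.real (qcell 0 ⁻¹' {qcell 0 x}) := fun x => by simp [pavg]
  have hLint : Integrable (fun x => L (qcell 0 x)) ν := by
    rw [← (lemA ν 0 L).1]
    have := ((lemB (n := n) 0 _).1.2 hH0).neg
    refine this.congr (ae_of_all _ fun x => ?_)
    simp only [Pi.neg_apply, hp0, hL, Real.negMulLog]
    ring
  have hLm : ∀ m, Integrable (fun x => pavg ν m x * L (qcell 0 x)) ∧
      ∫ x, pavg ν m x * L (qcell 0 x) = ∫ x, L (qcell 0 x) ∂ν := by
    intro m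
    have := lemA ν m (fun k => L (fun i => ⌊(k i : ℝ) / 2 ^ m⌋))
    simp only [← qcell_zero] at this
    exact ⟨this.1.2 hLint, this.2⟩
  have hpos : ∀ m x, 0 ≤ pavg ν m x := fun m x => by unfold pavg; positivity
  have hzero : ∀ m x, pavg ν 0 x = 0 → pavg ν m x = 0 := by
    intro m x h
    rw [hp0] at h
    have : ν.real (qcell m ⁻¹' {qcell m x}) ≤ ν.real (qcell 0 ⁻¹' {qcell 0 x}) := by
      refine measureReal_mono (fun y hy => ?_)
      have hy' : qcell m y = qcell m x := hy
      change qcell 0 y = qcell 0 x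
      rw [qcell_zero m y, qcell_zero m x, hy']
    have h0 : ν.real (qcell m ⁻¹' {qcell m x}) = 0 :=
      le_antisymm (this.trans h.le) measureReal_nonneg
    simp [pavg, h0]
  have hmeas : ∀ m, Measurable (pavg ν m) := fun m =>
    (measurable_of_countable (fun k : Fin n → ℤ =>
      (2 : ℝ) ^ (m * n) * ν.real (qcell m ⁻¹' {k}))).comp (measurable_qcell m)
  set a : ℕ → (Fin n → ℝ) → ℝ := fun m x =>
    Real.negMulLog (pavg ν m x) + pavg ν m x * Real.log C with ha_def
  set a0 : (Fin n → ℝ) → ℝ := fun x => Real.negMulLog (p x) + p x * Real.log C with ha0_def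
  set s : ℕ → (Fin n → ℝ) → ℝ := fun m x =>
    pavg ν m x * Real.log C - pavg ν m x * L (qcell 0 x) - pavg ν m x + pavg ν 0 x with hs_def
  set s0 : (Fin n → ℝ) → ℝ := fun x =>
    p x * Real.log C - p x * L (qcell 0 x) - p x + pavg ν 0 x with hs0_def
  have h0a : ∀ m x, 0 ≤ a m x := by
    intro m x
    have h1 : pavg ν m x ≤ C := pavg_le p ν hν m x C (by linarith) (fun y _ => hC y)
    simp only [ha_def, Real.negMulLog]
    rcases (hpos m x).eq_or_lt with h | h
    · simp [← h]
    · have := mul_le_mul_of_nonneg_left (Real.log_le_log h h1) h.le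
      linarith
  have has : ∀ m x, a m x ≤ s m x := by
    intro m x
    have := ent_ineq (pavg ν m x) (pavg ν 0 x) (hpos m x) (hpos 0 x) (hzero m x)
    have e : Real.log (pavg ν 0 x) = L (qcell 0 x) := by rw [hp0]
    rw [e] at this
    simp only [ha_def, hs_def]
    linarith
  have hsI : ∀ m, Integrable (s m) := fun m =>
    ((((ha1 m).mul_const _).sub (hLm m).1).sub (ha1 m)).add (ha1 0)
  have hs0I : Integrable s0 :=
    (((hp1.mul_const _).sub (hpI _ hLint)).sub hp1).add (ha1 0)
  have haI : ∀ m, Integrable (a m) := by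
    intro m
    refine (hsI m).mono' ?_ (ae_of_all _ fun x => ?_)
    · exact ((Real.continuous_negMulLog.measurable.comp (hmeas m)).add
        ((hmeas m).mul_const _)).aestronglyMeasurable
    · rw [Real.norm_of_nonneg (h0a m x)]; exact has m x
  have hnI : ∀ m, Integrable (fun x => Real.negMulLog (pavg ν m x)) := by
    intro m
    refine ((haI m).sub ((ha1 m).mul_const (Real.log C))).congr (ae_of_all _ fun x => ?_)
    simp [ha_def]
  have hn0I : Integrable (fun x => Real.negMulLog (p x)) := by
    refine hplogp.neg.congr (ae_of_all _ fun x => ?_)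
    simp [Real.negMulLog]
  have hsE : ∀ m, ∫ x, s m x = Real.log C - ∫ x, L (qcell 0 x) ∂ν := by
    intro m
    have i1 : Integrable (fun x => pavg ν m x * Real.log C) := (ha1 m).mul_const _
    have i2 : Integrable (fun x => pavg ν m x * Real.log C - pavg ν m x * L (qcell 0 x)) :=
      i1.sub (hLm m).1
    have i3 : Integrable (fun x => pavg ν m x * Real.log C - pavg ν m x * L (qcell 0 x)
      - pavg ν m x) := i2.sub (ha1 m)
    simp only [hs_def]
    rw [integral_add i3 (ha1 0), integral_sub i2 (ha1 m), integral_sub i1 (hLm m).1,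
      integral_mul_const, ha1E, ha1E, (hLm m).2]
    ring
  have hs0E : ∫ x, s0 x = Real.log C - ∫ x, L (qcell 0 x) ∂ν := by
    have i1 : Integrable (fun x => p x * Real.log C) := hp1.mul_const _
    have i2 : Integrable (fun x => p x * Real.log C - p x * L (qcell 0 x)) :=
      i1.sub (hpI _ hLint)
    have i3 : Integrable (fun x => p x * Real.log C - p x * L (qcell 0 x)
      - p x) := i2.sub hp1
    simp only [hs0_def]
    rw [integral_add i3 (ha1 0), integral_sub i2 hp1, integral_sub i1 (hpI _ hLint),
      integral_mul_const, ha1E, hp1E, hpE]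
    ring
  have hpt := pavg_tendsto p hp hc ν hν
  have hmain := pratt_aux a s a0 s0 haI hsI hs0I h0a has
    (fun x => ((Real.continuous_negMulLog.tendsto _).comp (hpt x)).add ((hpt x).mul_const _))
    (fun x => ((((hpt x).mul_const _).sub ((hpt x).mul_const _)).sub (hpt x)).add
      tendsto_const_nhds)
    (fun m => by rw [hsE, hs0E])
  have haE : ∀ m, ∫ x, a m x = (∫ x, Real.negMulLog (pavg ν m x)) + Real.log C := by
    intro m
    simp only [ha_def]
    rw [integral_add (hnI m) ((ha1 m).mul_const _), integral_mul_const, ha1E, one_mul]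
  have ha0E : ∫ x, a0 x = (-∫ x, p x * Real.log (p x)) + Real.log C := by
    simp only [ha0_def]
    rw [integral_add hn0I (hp1.mul_const _), integral_mul_const, hp1E, one_mul, ← integral_neg]
    simp [Real.negMulLog]
  rw [ha0E] at hmain
  have hfin := hmain.sub_const (Real.log C)
  rw [add_sub_cancel_right] at hfin
  refine hfin.congr fun m => ?_
  rw [haE, add_sub_cancel_right]
  -- relate integral and sum
  set w : ℝ := 2 ^ (m * n) with hw
  have hwpos : 0 < w := by positivity
  have hlogw : Real.log w = (m : ℝ) * (n : ℝ) * Real.log 2 := by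
    rw [hw, Real.log_pow]; push_cast; ring
  set q : (Fin n → ℤ) → ℝ := fun k => ν.real (qcell m ⁻¹' {k}) with hq
  have hB1 := lemB (n := n) m (fun k => w * q k)
  have hB2 := lemB (n := n) m (fun k => Real.negMulLog (w * q k))
  have hS1 := hB1.1.1 (ha1 m)
  have hS2 := hB2.1.1 (hnI m)
  have hE1 : (1 : ℝ) = w⁻¹ * ∑' k, w * q k := (ha1E m).symm.trans (hB1.2 hS1)
  have hE2 : ∫ x, Real.negMulLog (pavg ν m x) = w⁻¹ * ∑' k, Real.negMulLog (w * q k) :=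
    hB2.2 hS2
  have hq1 : ∑' k, q k = 1 := by
    rw [hE1, ← tsum_mul_left]
    refine tsum_congr fun k => ?_
    field_simp
  have hqs : Summable q := by
    refine (hS1.mul_left w⁻¹).congr fun k => ?_
    field_simp
  have hterm : ∀ k, Real.negMulLog (q k) =
      w⁻¹ * Real.negMulLog (w * q k) + q k * Real.log w := by
    intro k
    rw [Real.negMulLog_mul]
    simp only [Real.negMulLog]
    field_simp
    ring
  rw [hE2, tsum_congr hterm, (hS2.mul_left w⁻¹).tsum_add (hqs.mul_right _), tsum_mul_left,
    tsum_mul_right, hq1, hlogw]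
  ring

theorem discretized_entropy_tendsto_differential_entropy
    {Ω : Type*} [MeasurableSpace Ω] (P : Measure Ω) [IsProbabilityMeasure P]
    {n : ℕ} (z : Ω → (Fin n → ℝ)) (hz : Measurable z)
    (p : (Fin n → ℝ) → ℝ) (hp_nonneg : ∀ x, 0 ≤ p x)
    (hdensity : P.map z = volume.withDensity (fun x => ENNReal.ofReal (p x)))
    (zm : ℕ → Ω → (Fin n → ℤ))
    (hzm : zm = fun m ω i => ⌊(2 : ℝ) ^ m * z ω i⌋)
    -- (a) the density is continuous and bounded
    (hp_cont : Continuous p) (hp_bdd : ∃ C : ℝ, ∀ x, p x ≤ C)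
    -- (b) `∫ |p log p| < ∞`
    (hplogp : Integrable (fun x => p x * Real.log (p x)))
    -- (c) the Shannon entropy of the coarsest discretization is finite
    (hH0 : Summable fun k : Fin n → ℤ =>
      Real.negMulLog (P (zm 0 ⁻¹' {k})).toReal) :
    Tendsto
      (fun m : ℕ => shannonEntropy P (zm m) - (m : ℝ) * (n : ℝ) * Real.log 2)
      atTop (nhds (-∫ x, p x * Real.log (p x))) := by
  obtain ⟨C, hC⟩ := hp_bdd
  have hprob : IsProbabilityMeasure (P.map z) := Measure.isProbabilityMeasure_map hz.aemeasurable
  have hpre : ∀ m k, (P (zm m ⁻¹' {k})).toReal = (P.map z).real (qcell m ⁻¹' {k}) := by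
    intro m k
    rw [Measure.real, Measure.map_apply hz (measurable_qcell m (measurableSet_singleton k)), hzm]
    rfl
  simp only [shannonEntropy, hpre] at hH0 ⊢
  exact core p hp_nonneg hp_cont (max C 1) (le_max_right _ _)
    (fun x => (hC x).trans (le_max_left _ _)) (P.map z) hdensity hplogp hH0
end

section
/- Let μ and ν be finite measures on a measurable space α, and let f : α → β be a measurable map into a measurable space β. Then the Kullback–Leibler divergence satisfies D_KL(μ.map f ∥ ν.map f) ≤ D_KL(μ ∥ ν); in particular, Kullback–Leibler divergence can only decrease under taking the joint law of a sub-collection of coordinates (marginalization). -/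
open MeasureTheory ProbabilityTheory
open scoped Classical

/-- Kullback–Leibler divergence between two measures, valued in `[0,∞]`: it equals
`∫ log(dμ/dν) dμ` when `μ ≪ ν` and the log-density is `μ`-integrable, `∞` otherwise. -/
noncomputable def klDiv {α : Type*} [MeasurableSpace α] (μ ν : Measure α) : ENNReal :=
  if μ ≪ ν ∧ Integrable (fun x => Real.log (μ.rnDeriv ν x).toReal) μ then
    ENNReal.ofReal (∫ x, Real.log (μ.rnDeriv ν x).toReal ∂μ)
  else ⊤

theorem klDiv_map_le
    {α β : Type*} [MeasurableSpace α] [MeasurableSpace β]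
    (μ ν : Measure α) [IsFiniteMeasure μ] [IsFiniteMeasure ν]
    (f : α → β) (hf : Measurable f) :
    klDiv (μ.map f) (ν.map f) ≤ klDiv μ ν := by
  by_cases h : μ ≪ ν ∧ Integrable (fun x => Real.log (μ.rnDeriv ν x).toReal) μ
  · obtain ⟨hac, hint⟩ := h
    have hint0 : Integrable (llr μ ν) μ := hint
    have hac' : μ.map f ≪ ν.map f := hac.map hf
    have hint' : Integrable (llr (μ.map f) (ν.map f)) (μ.map f) :=
      InformationTheory.integrable_llr_map hac hf hint0
    have key := ENNReal.toReal_mono (InformationTheory.klDiv_ne_top hac hint0)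
      (InformationTheory.klDiv_map_le μ ν hf)
    rw [InformationTheory.toReal_klDiv hac hint0,
      InformationTheory.toReal_klDiv hac' hint',
      map_measureReal_apply hf MeasurableSet.univ,
      map_measureReal_apply hf MeasurableSet.univ, Set.preimage_univ] at key
    have e1 : klDiv μ ν = ENNReal.ofReal (∫ x, llr μ ν x ∂μ) := if_pos ⟨hac, hint⟩
    have e2 : klDiv (μ.map f) (ν.map f)
        = ENNReal.ofReal (∫ x, llr (μ.map f) (ν.map f) x ∂(μ.map f)) := if_pos ⟨hac', hint'⟩
    rw [e1, e2]
    exact ENNReal.ofReal_le_ofReal (by linarith)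
  · have e : klDiv μ ν = ⊤ := if_neg h
    rw [e]
    exact le_top
end
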